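/- For all n, N ∈ ℕ₊ and every integer m ≥ 2 there exists a constant C = C(m, N, n) such that for all smooth functions u : ℝⁿ → ℝ^N and Ψ : ℝ^N → ℝ whose derivatives up to order m are bounded: [Ψ∘u]_m ≤ C Σ_{i=1}^{m} [Ψ]_i · [u]_1^{(i−1)m/(m−1)} · [u]_m^{(m−i)/(m−1)}. -/

import Mathlib

noncomputable section

/-- Partial derivative in the i-th coordinate direction on ℝⁿ. -/
noncomputable def pd {n : ℕ} {E : Type*} [NormedAddCommGroup E] [NormedSpace ℝ E]
    (i : Fin n) (f : (Fin n → ℝ) → E) (x : Fin n → ℝ) : E :=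
  deriv (fun s => f (Function.update x i s)) (x i)

/-- Iterated partial derivative ∂^β for a list β of coordinate directions. -/
noncomputable def pdList {n : ℕ} {E : Type*} [NormedAddCommGroup E] [NormedSpace ℝ E] :
    List (Fin n) → ((Fin n → ℝ) → E) → ((Fin n → ℝ) → E)
  | [], f => f
  | i :: l, f => pd i (pdList l f)

/-- [f]_m : the maximum over multi-indices β with |β| = m of sup ‖∂^β f‖ (sup norm taken
over ℝⁿ; for vector-valued f the norm includes the max over components). -/
noncomputable def semiNorm {n : ℕ} {E : Type*} [NormedAddCommGroup E] [NormedSpace ℝ E]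
    (m : ℕ) (f : (Fin n → ℝ) → E) : ℝ :=
  ⨆ β : Fin m → Fin n, ⨆ x, ‖pdList (List.ofFn β) f x‖

/-- All iterated partial derivatives of order ≤ m are (uniformly) bounded. -/
def DerivsBounded {n : ℕ} {E : Type*} [NormedAddCommGroup E] [NormedSpace ℝ E]
    (m : ℕ) (f : (Fin n → ℝ) → E) : Prop :=
  ∀ j, j ≤ m → ∃ B : ℝ, ∀ (β : Fin j → Fin n) (x : Fin n → ℝ),
    ‖pdList (List.ofFn β) f x‖ ≤ B

section PartialDerivatives

variable {n : ℕ} {E : Type*} [NormedAddCommGroup E] [NormedSpace ℝ E]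

/-- Iterated partial derivatives are the iterated Fréchet derivative on basis vectors. -/
theorem pdList_ofFn_eq_iteratedFDeriv {f : (Fin n → ℝ) → E} (hf : ContDiff ℝ (⊤ : ℕ∞) f)
    (j : ℕ) (β : Fin j → Fin n) (x : Fin n → ℝ) :
    pdList (List.ofFn β) f x = iteratedFDeriv ℝ j f x fun k => Pi.single (β k) 1 := by
  induction j generalizing x with
  | zero => simp [pdList]
  | succ j ih =>
    have hd : Differentiable ℝ (iteratedFDeriv ℝ j f) :=
      hf.differentiable_iteratedFDeriv (mod_cast ENat.natCast_lt_top j)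
    rw [List.ofFn_succ, pdList, funext (ih fun k => β k.succ), pd, iteratedFDeriv_succ_apply_left]
    set v : Fin j → Fin n → ℝ := fun k => Pi.single (β k.succ) 1 with hv
    have h1 : HasFDerivAt (fun y => iteratedFDeriv ℝ j f y v)
        (fderiv ℝ (fun y => iteratedFDeriv ℝ j f y v) x)
        (Function.update x (β 0) (x (β 0))) := by
      rw [Function.update_eq_self]
      exact ((hd x).continuousMultilinear_apply_const v).hasFDerivAt
    have h2 := h1.comp_hasDerivAt (x (β 0)) (hasDerivAt_update x (β 0) (x (β 0)))
    rw [show (fun s => iteratedFDeriv ℝ j f (Function.update x (β 0) s) v) =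
      (fun y => iteratedFDeriv ℝ j f y v) ∘ Function.update x (β 0) from rfl, h2.deriv,
      fderiv_continuousMultilinear_apply_const_apply (hd x)]
    rfl

theorem norm_pdList_ofFn_le {f : (Fin n → ℝ) → E} (hf : ContDiff ℝ (⊤ : ℕ∞) f)
    (j : ℕ) (β : Fin j → Fin n) (x : Fin n → ℝ) :
    ‖pdList (List.ofFn β) f x‖ ≤ ‖iteratedFDeriv ℝ j f x‖ := by
  rw [pdList_ofFn_eq_iteratedFDeriv hf]
  refine (ContinuousMultilinearMap.le_opNorm _ _).trans_eq ?_
  simp [Pi.norm_single]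

theorem norm_le_of_norm_apply_single_le {j : ℕ} (A : (Fin n → ℝ) [×j]→L[ℝ] E) {B : ℝ}
    (hB : 0 ≤ B) (h : ∀ β : Fin j → Fin n, ‖A fun k => Pi.single (β k) 1‖ ≤ B) :
    ‖A‖ ≤ (n : ℝ) ^ j * B := by
  refine ContinuousMultilinearMap.opNorm_le_bound (by positivity) fun v => ?_
  have hv : v = fun k => ∑ i, v k i • (Pi.single i 1 : Fin n → ℝ) :=
    funext fun k => pi_eq_sum_univ' (v k)
  calc ‖A v‖ = ‖∑ β : Fin j → Fin n, (∏ k, v k (β k)) • A fun k => Pi.single (β k) 1‖ := by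
        conv_lhs => rw [hv]
        rw [ContinuousMultilinearMap.map_sum]
        simp_rw [ContinuousMultilinearMap.map_smul_univ]
    _ ≤ ∑ β : Fin j → Fin n, (∏ k, ‖v k‖) * B := by
        refine (norm_sum_le _ _).trans (Finset.sum_le_sum fun β _ => ?_)
        rw [norm_smul, norm_prod]
        gcongr with k
        · exact norm_le_pi_norm (v k) (β k)
        · exact h β
    _ = (n : ℝ) ^ j * B * ∏ k, ‖v k‖ := by
        simp
        ring

theorem semiNorm_nonneg (m : ℕ) (f : (Fin n → ℝ) → E) : 0 ≤ semiNorm m f :=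
  Real.iSup_nonneg fun _ => Real.iSup_nonneg fun _ => norm_nonneg _

theorem norm_pdList_ofFn_le_semiNorm {f : (Fin n → ℝ) → E} {m j : ℕ} (h : DerivsBounded m f)
    (hj : j ≤ m) (β : Fin j → Fin n) (x : Fin n → ℝ) :
    ‖pdList (List.ofFn β) f x‖ ≤ semiNorm j f := by
  obtain ⟨B, hB⟩ := h j hj
  have h1 : BddAbove (Set.range fun x => ‖pdList (List.ofFn β) f x‖) :=
    ⟨B, by rintro _ ⟨y, rfl⟩; exact hB β y⟩
  have h2 : BddAbove (Set.range fun β : Fin j → Fin n => ⨆ x, ‖pdList (List.ofFn β) f x‖) :=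
    (Set.finite_range _).bddAbove
  exact (le_ciSup h1 x).trans (le_ciSup h2 β)

theorem norm_iteratedFDeriv_le_semiNorm {f : (Fin n → ℝ) → E} (hf : ContDiff ℝ (⊤ : ℕ∞) f)
    {m j : ℕ} (h : DerivsBounded m f) (hj : j ≤ m) (x : Fin n → ℝ) :
    ‖iteratedFDeriv ℝ j f x‖ ≤ (n : ℝ) ^ j * semiNorm j f :=
  norm_le_of_norm_apply_single_le _ (semiNorm_nonneg j f) fun β => by
    rw [← pdList_ofFn_eq_iteratedFDeriv hf]
    exact norm_pdList_ofFn_le_semiNorm h hj β x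

theorem semiNorm_le_of_norm_iteratedFDeriv_le {f : (Fin n → ℝ) → E}
    (hf : ContDiff ℝ (⊤ : ℕ∞) f) {m : ℕ} {B : ℝ} (hB : 0 ≤ B)
    (h : ∀ x, ‖iteratedFDeriv ℝ m f x‖ ≤ B) : semiNorm m f ≤ B :=
  Real.iSup_le (fun β => Real.iSup_le (fun x => (norm_pdList_ofFn_le hf m β x).trans (h x)) hB) hB

end PartialDerivatives

section Interpolation

variable {E F : Type*} [NormedAddCommGroup E] [NormedSpace ℝ E] [NormedAddCommGroup F]
  [NormedSpace ℝ F]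

/-- The Landau inequality at scale `h`. -/
theorem norm_fderiv_le_of_lipschitz_fderiv {G : E → F} (hG : Differentiable ℝ G) {A K h : ℝ}
    (hh : 0 < h) (hA : ∀ x, ‖G x‖ ≤ A) (hK : ∀ x y, ‖fderiv ℝ G x - fderiv ℝ G y‖ ≤ K * ‖x - y‖)
    (hK0 : 0 ≤ K) (x : E) : ‖fderiv ℝ G x‖ ≤ 2 / h * A + h * K := by
  have hA0 : 0 ≤ A := (norm_nonneg _).trans (hA x)
  refine ContinuousLinearMap.opNorm_le_of_unit_norm (by positivity) fun v hv => ?_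
  have hnv : ‖h • v‖ = h := by rw [norm_smul, hv, mul_one, Real.norm_of_nonneg hh.le]
  have h1 := Convex.norm_image_sub_le_of_norm_fderiv_le' (𝕜 := ℝ) (f := G) (C := K * h)
    (φ := fderiv ℝ G x) (s := Metric.closedBall x h) (x := x) (y := x + h • v)
    (fun y _ => hG y)
    (fun y hy => (hK y x).trans (by
      rw [← dist_eq_norm]
      exact mul_le_mul_of_nonneg_left hy hK0))
    (convex_closedBall x h) (Metric.mem_closedBall_self hh.le)
    (by simp [hnv])
  rw [add_sub_cancel_left, hnv, map_smul] at h1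
  have h2 : ‖h • fderiv ℝ G x v‖ ≤ K * h * h + (A + A) := by
    calc ‖h • fderiv ℝ G x v‖
        = ‖(G (x + h • v) - G x) - (G (x + h • v) - G x - h • fderiv ℝ G x v)‖ := by
          congr 1; abel
      _ ≤ ‖G (x + h • v) - G x‖ + ‖G (x + h • v) - G x - h • fderiv ℝ G x v‖ := norm_sub_le _ _
      _ ≤ (A + A) + K * h * h := by
          gcongr
          exact (norm_sub_le _ _).trans (add_le_add (hA _) (hA _))
      _ = _ := by ring
  rw [norm_smul, Real.norm_of_nonneg hh.le] at h2
  have h3 : ‖fderiv ℝ G x v‖ ≤ (K * h * h + (A + A)) / h := by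
    rw [le_div_iff₀ hh]; linarith
  refine h3.trans_eq ?_
  field_simp
  ring

theorem norm_iteratedFDeriv_succ_le {u : E → F} (hu : ContDiff ℝ (⊤ : ℕ∞) u) (j : ℕ) {A K h : ℝ}
    (hh : 0 < h) (hA : ∀ x, ‖iteratedFDeriv ℝ j u x‖ ≤ A)
    (hK : ∀ x, ‖iteratedFDeriv ℝ (j + 2) u x‖ ≤ K) (x : E) :
    ‖iteratedFDeriv ℝ (j + 1) u x‖ ≤ 2 / h * A + h * K := by
  have hd (i : ℕ) : Differentiable ℝ (iteratedFDeriv ℝ i u) :=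
    hu.differentiable_iteratedFDeriv (mod_cast ENat.natCast_lt_top i)
  rw [← norm_fderiv_iteratedFDeriv]
  refine norm_fderiv_le_of_lipschitz_fderiv (hd j) hh hA (fun y z => ?_)
    ((norm_nonneg _).trans (hK x)) x
  have h1 := Convex.norm_image_sub_le_of_norm_fderiv_le (𝕜 := ℝ)
    (f := iteratedFDeriv ℝ (j + 1) u) (C := K) (s := Set.univ) (x := z) (y := y)
    (fun y _ => hd _ y) (fun y _ => by rw [norm_fderiv_iteratedFDeriv]; exact hK y)
    convex_univ trivial trivial
  rwa [iteratedFDeriv_succ_eq_comp_left, Function.comp_apply, Function.comp_apply, ← dist_eq_norm,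
    LinearIsometryEquiv.dist_map, dist_eq_norm] at h1

/-- The Landau inequalities, at every scale, between consecutive terms of index `1, …, m`. -/
def LandauSeq (m : ℕ) (M : ℕ → ℝ) : Prop :=
  ∀ j, 1 ≤ j → j + 2 ≤ m → ∀ h : ℝ, 0 < h → M (j + 1) ≤ 2 / h * M j + h * M (j + 2)

theorem LandauSeq.mono {m m' : ℕ} {M : ℕ → ℝ} (h : LandauSeq m M) (hm : m' ≤ m) :
    LandauSeq m' M :=
  fun j h1 h2 => h j h1 (h2.trans hm)

theorem LandauSeq.scale {m : ℕ} {M : ℕ → ℝ} (hM : LandauSeq m M) {t : ℝ} (ht : 0 < t) :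
    LandauSeq m fun j => t ^ j * M j := by
  intro j h1 h2 h hh
  have h3 := mul_le_mul_of_nonneg_left (hM j h1 h2 (h * t) (by positivity))
    (pow_pos ht (j + 1)).le
  refine h3.trans_eq ?_
  field_simp
  ring

theorem LandauSeq.exists_le_succ (k : ℕ) : ∀ ε : ℝ, 0 < ε → ∃ C : ℝ, 0 ≤ C ∧ ∀ M : ℕ → ℝ,
    (∀ j, 0 ≤ M j) → LandauSeq (k + 2) M → M (k + 1) ≤ ε * M (k + 2) + C * M 1 := by
  induction k with
  | zero =>
    intro ε hε
    refine ⟨1, zero_le_one, fun M h0 _ => ?_⟩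
    have := mul_nonneg hε.le (h0 2)
    simpa using this
  | succ k ih =>
    intro ε hε
    obtain ⟨C, hC, h⟩ := ih (ε / 8) (by positivity)
    refine ⟨8 * C / ε, by positivity, fun M h0 hM => ?_⟩
    have h1 := h M h0 (hM.mono (by omega))
    have h2 := hM (k + 1) (by omega) le_rfl (ε / 2) (by positivity)
    have h3 : 2 / (ε / 2) * M (k + 1) ≤
        2 / (ε / 2) * (ε / 8 * M (k + 2) + C * M 1) := by gcongr
    have h4 : 2 / (ε / 2) * (ε / 8 * M (k + 2) + C * M 1) =
        M (k + 2) / 2 + (8 * C / ε * M 1) / 2 := by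
      field_simp
      ring
    have e1 : k + 1 + 1 = k + 2 := rfl
    rw [e1] at h2 ⊢
    linarith

theorem LandauSeq.exists_le_add (j m : ℕ) (hj : 1 ≤ j) (hm : j ≤ m) : ∃ C : ℝ, 0 ≤ C ∧
    ∀ M : ℕ → ℝ, (∀ j, 0 ≤ M j) → LandauSeq m M → M j ≤ C * (M 1 + M m) := by
  induction m, hm using Nat.le_induction with
  | base => exact ⟨1, zero_le_one, fun M h0 _ => by linarith [h0 1]⟩
  | succ m hm ih =>
    obtain ⟨C, hC, h⟩ := ih
    obtain ⟨k, rfl⟩ : ∃ k, m = k + 1 := ⟨m - 1, by omega⟩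
    obtain ⟨D, hD, h'⟩ := LandauSeq.exists_le_succ k 1 one_pos
    refine ⟨C * (1 + D), by positivity, fun M h0 hM => ?_⟩
    have h1 := h M h0 (hM.mono (by omega))
    have h2 := h' M h0 hM
    refine h1.trans ?_
    rw [mul_assoc]
    refine mul_le_mul_of_nonneg_left ?_ hC
    have := mul_nonneg hD (h0 (k + 2))
    have e1 : k + 1 + 1 = k + 2 := rfl
    rw [e1]
    linarith

theorem LandauSeq.exists_uniform (m : ℕ) : ∃ C : ℝ, 0 ≤ C ∧ ∀ M : ℕ → ℝ, (∀ j, 0 ≤ M j) →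
    LandauSeq m M → ∀ j, 1 ≤ j → j ≤ m → M j ≤ C * (M 1 + M m) := by
  choose! C hC h using fun j => fun p : 1 ≤ j ∧ j ≤ m => LandauSeq.exists_le_add j m p.1 p.2
  refine ⟨∑ j ∈ Finset.Icc 1 m, C j, Finset.sum_nonneg fun j hj => hC j (Finset.mem_Icc.1 hj),
    fun M h0 hM j h1 h2 => (h j ⟨h1, h2⟩ M h0 hM).trans ?_⟩
  refine mul_le_mul_of_nonneg_right ?_ (add_nonneg (h0 _) (h0 _))
  exact Finset.single_le_sum (f := C) (fun i hi => hC i (Finset.mem_Icc.1 hi))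
    (Finset.mem_Icc.2 ⟨h1, h2⟩)

/-- Interpolation of intermediate derivatives, with the extreme bounds written as `s * L` and
`s * L ^ m`. -/
theorem exists_norm_iteratedFDeriv_le_interpolation (m : ℕ) : ∃ K : ℝ, 1 ≤ K ∧
    ∀ u : E → F, ContDiff ℝ (⊤ : ℕ∞) u →
      (∀ j, j ≤ m → ∃ B, ∀ x, ‖iteratedFDeriv ℝ j u x‖ ≤ B) →
      ∀ s L : ℝ, 0 < s → 0 < L → (∀ x, ‖iteratedFDeriv ℝ 1 u x‖ ≤ s * L) →
        (∀ x, ‖iteratedFDeriv ℝ m u x‖ ≤ s * L ^ m) →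
        ∀ j, 1 ≤ j → j ≤ m → ∀ x, ‖iteratedFDeriv ℝ j u x‖ ≤ s * (K * L) ^ j := by
  obtain ⟨C, hC, h⟩ := LandauSeq.exists_uniform m
  refine ⟨2 * C + 1, by linarith, fun u hu hb s L hs hL h1 hm j hj1 hjm x => ?_⟩
  set M : ℕ → ℝ := fun j => ⨆ x, ‖iteratedFDeriv ℝ j u x‖
  have h0 (j) : 0 ≤ M j := Real.iSup_nonneg fun _ => norm_nonneg _
  have hle (j) (hj : j ≤ m) (x) : ‖iteratedFDeriv ℝ j u x‖ ≤ M j := by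
    obtain ⟨B, hB⟩ := hb j hj
    exact le_ciSup (f := fun x => ‖iteratedFDeriv ℝ j u x‖)
      ⟨B, by rintro _ ⟨y, rfl⟩; exact hB y⟩ x
  have hM : LandauSeq m M := fun j _ h2 t ht => ciSup_le fun x =>
    norm_iteratedFDeriv_succ_le hu j ht (hle j (by omega)) (hle (j + 2) h2) x
  have h2 := h _ (fun j => mul_nonneg (pow_nonneg (inv_pos.2 hL).le j) (h0 j))
    (hM.scale (inv_pos.2 hL)) j hj1 hjm
  have h3 : L⁻¹ ^ 1 * M 1 ≤ s := by
    have : M 1 ≤ s * L := ciSup_le h1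
    calc L⁻¹ ^ 1 * M 1 ≤ L⁻¹ ^ 1 * (s * L) := by gcongr
      _ = s := by field_simp
  have h4 : L⁻¹ ^ m * M m ≤ s := by
    have : M m ≤ s * L ^ m := ciSup_le hm
    calc L⁻¹ ^ m * M m ≤ L⁻¹ ^ m * (s * L ^ m) := by gcongr
      _ = s := by rw [inv_pow]; field_simp
  have h5 : L⁻¹ ^ j * M j ≤ (2 * C + 1) * s := by
    refine h2.trans ?_
    calc C * (L⁻¹ ^ 1 * M 1 + L⁻¹ ^ m * M m) ≤ C * (s + s) := by gcongr
      _ ≤ (2 * C + 1) * s := by linarith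
  have h6 : M j ≤ (2 * C + 1) * s * L ^ j := by
    rwa [inv_pow, inv_mul_le_iff₀ (by positivity), mul_comm] at h5
  refine (hle j hjm x).trans (h6.trans ?_)
  have h7 : 2 * C + 1 ≤ (2 * C + 1) ^ j := le_self_pow₀ (by linarith) (by omega)
  rw [mul_pow]
  calc (2 * C + 1) * s * L ^ j ≤ (2 * C + 1) ^ j * s * L ^ j := by gcongr
    _ = _ := by ring

end Interpolation

section Composition

variable {E F G : Type*} [NormedAddCommGroup E] [NormedSpace ℝ E] [NormedAddCommGroup F]
  [NormedSpace ℝ F] [NormedAddCommGroup G] [NormedSpace ℝ G]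

theorem norm_iteratedFDeriv_comp_le_sum {u : E → F} {Ψ : F → G} (hu : ContDiff ℝ (⊤ : ℕ∞) u)
    (hΨ : ContDiff ℝ (⊤ : ℕ∞) Ψ) {m : ℕ} (hm : m ≠ 0) (x : E) {s L : ℝ} (hs : 0 < s)
    {P : ℕ → ℝ} (hP : ∀ i, 1 ≤ i → i ≤ m → ‖iteratedFDeriv ℝ i Ψ (u x)‖ ≤ P i)
    (hL : ∀ j, 1 ≤ j → j ≤ m → ‖iteratedFDeriv ℝ j u x‖ ≤ s * L ^ j) :
    ‖iteratedFDeriv ℝ m (Ψ ∘ u) x‖ ≤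
      m.factorial * (∑ i ∈ Finset.Icc 1 m, s ^ i * P i) * L ^ m := by
  set v : E → F := s⁻¹ • u with hv
  set Φ : F → G := fun y => Ψ (s • y) - Ψ (u x) with hΦ
  have hvs : ContDiff ℝ (⊤ : ℕ∞) v := hu.const_smul s⁻¹
  have hΨs : ContDiff ℝ (⊤ : ℕ∞) fun y => Ψ (s • y) := hΨ.comp (contDiff_id.const_smul s)
  have hΦs : ContDiff ℝ (⊤ : ℕ∞) Φ := hΨs.sub contDiff_const
  have hsv (y : E) : s • v y = u y := by simp [hv, smul_smul, hs.ne']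
  have hle (k : ℕ) : ((k : ℕ∞) : WithTop ℕ∞) ≤ ((⊤ : ℕ∞) : WithTop ℕ∞) := mod_cast le_top
  have hcomp : iteratedFDeriv ℝ m (Φ ∘ v) x = iteratedFDeriv ℝ m (Ψ ∘ u) x := by
    have : Φ ∘ v = (Ψ ∘ u) - fun _ => Ψ (u x) := by
      ext y
      simp [hΦ, hsv]
    rw [this, iteratedFDeriv_sub_apply ((hΨ.comp hu).contDiffAt.of_le (hle m)) contDiffAt_const,
      iteratedFDeriv_const_of_ne hm]
    simp
  have hterm (i) (hi : i ∈ Finset.Icc 1 m) : 0 ≤ s ^ i * P i := by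
    rw [Finset.mem_Icc] at hi
    exact mul_nonneg (pow_nonneg hs.le i) ((norm_nonneg _).trans (hP i hi.1 hi.2))
  rw [← hcomp]
  refine norm_iteratedFDeriv_comp_le hΦs hvs (hle m) x (fun i hi => ?_) (fun j h1 h2 => ?_)
  · rcases Nat.eq_zero_or_pos i with rfl | hi0
    · simpa [hΦ, hsv] using Finset.sum_nonneg hterm
    · have : Φ = (fun y => Ψ (s • y)) - fun _ => Ψ (u x) := rfl
      rw [this, iteratedFDeriv_sub_apply (hΨs.contDiffAt.of_le (hle i)) contDiffAt_const,
        iteratedFDeriv_const_of_ne hi0.ne', iteratedFDeriv_comp_const_smul s (hΨ.of_le (hle i))]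
      simp only [Pi.zero_apply, sub_zero, hsv, norm_smul, norm_pow, Real.norm_of_nonneg hs.le]
      exact (mul_le_mul_of_nonneg_left (hP i hi0 hi) (pow_nonneg hs.le i)).trans
        (Finset.single_le_sum (f := fun i => s ^ i * P i) hterm (Finset.mem_Icc.2 ⟨hi0, hi⟩))
  · rw [hv, iteratedFDeriv_const_smul_apply (hu.contDiffAt.of_le (hle j)), norm_smul, norm_inv,
      Real.norm_of_nonneg hs.le, inv_mul_le_iff₀ hs]
    exact hL j h1 h2

end Composition

/-- With `L ^ (m - 1) = b / a` and `s = a / L`, the product `s ^ i * L ^ m` is the geometric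
interpolation weight between `a` and `b`. -/
theorem exists_interpolation_scale {m : ℕ} (hm : 2 ≤ m) {a b : ℝ} (ha : 0 < a) (hb : 0 < b) :
    ∃ s L : ℝ, 0 < s ∧ 0 < L ∧ s * L = a ∧ s * L ^ m = b ∧ ∀ i : ℕ, s ^ i * L ^ m =
      a ^ (((i : ℝ) - 1) * m / ((m : ℝ) - 1)) * b ^ (((m : ℝ) - i) / ((m : ℝ) - 1)) := by
  have hm1 : (m : ℝ) - 1 ≠ 0 := by
    have : (2 : ℝ) ≤ m := mod_cast hm
    linarith
  have key (p q : ℝ) : a ^ p * b ^ q = Real.exp (p * Real.log a + q * Real.log b) := by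
    rw [Real.exp_add, Real.rpow_def_of_pos ha, Real.rpow_def_of_pos hb, mul_comm p, mul_comm q]
  have hpow (p : ℝ) (k : ℕ) : Real.exp p ^ k = Real.exp (k * p) := (Real.exp_nat_mul p k).symm
  refine ⟨Real.exp ((m * Real.log a - Real.log b) / (m - 1)),
    Real.exp ((Real.log b - Real.log a) / (m - 1)), Real.exp_pos _, Real.exp_pos _, ?_, ?_, ?_⟩
  · rw [← Real.exp_add]
    refine Eq.trans ?_ (Real.exp_log ha)
    congr 1
    field_simp
    ring
  · rw [hpow, ← Real.exp_add]
    refine Eq.trans ?_ (Real.exp_log hb)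
    congr 1
    field_simp
    ring
  · intro i
    rw [key, hpow, hpow, ← Real.exp_add]
    congr 1
    field_simp
    ring

/-- the chain-rule (Faà di Bruno type) Hölder estimate
[Ψ∘u]_m ≤ C Σ_{i=1}^m [Ψ]_i [u]_1^{(i−1)m/(m−1)} [u]_m^{(m−i)/(m−1)}. -/
theorem composition_seminorm_estimate (n N : ℕ) (hn : 0 < n) (hN : 0 < N)
    (m : ℕ) (hm : 2 ≤ m) :
    ∃ C : ℝ, 0 < C ∧
      ∀ (u : (Fin n → ℝ) → Fin N → ℝ) (Ψ : (Fin N → ℝ) → ℝ),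
        ContDiff ℝ (⊤ : ℕ∞) u → ContDiff ℝ (⊤ : ℕ∞) Ψ →
        DerivsBounded m u → DerivsBounded m Ψ →
        semiNorm m (Ψ ∘ u) ≤
          C * ∑ i ∈ Finset.Icc 1 m,
            semiNorm i Ψ * (semiNorm 1 u) ^ (((i : ℝ) - 1) * m / ((m : ℝ) - 1))
              * (semiNorm m u) ^ (((m : ℝ) - i) / ((m : ℝ) - 1)) := by
  obtain ⟨K, hK1, hK⟩ :=
    exists_norm_iteratedFDeriv_le_interpolation (E := Fin n → ℝ) (F := Fin N → ℝ) m
  set c : ℝ := (n : ℝ) ^ m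
  have hn1 : (1 : ℝ) ≤ n := mod_cast hn
  have hN1 : (1 : ℝ) ≤ N := mod_cast hN
  have hm2 : (2 : ℝ) ≤ m := mod_cast hm
  have hc1 : 1 ≤ c := one_le_pow₀ hn1
  have hc0 : 0 < c := by linarith
  refine ⟨m.factorial * K ^ m * (N : ℝ) ^ m * c ^ m, by positivity, fun u Ψ hu hΨ hub hΨb => ?_⟩
  have hS1 := semiNorm_nonneg 1 u
  have hSm := semiNorm_nonneg m u
  have main (ε : ℝ) (hε : 0 < ε) : semiNorm m (Ψ ∘ u) ≤
      m.factorial * K ^ m * (N : ℝ) ^ m * c ^ m * ∑ i ∈ Finset.Icc 1 m,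
        semiNorm i Ψ * (semiNorm 1 u + ε) ^ (((i : ℝ) - 1) * m / ((m : ℝ) - 1))
          * (semiNorm m u + ε) ^ (((m : ℝ) - i) / ((m : ℝ) - 1)) := by
    have ha : 0 < semiNorm 1 u + ε := by linarith
    have hb : 0 < semiNorm m u + ε := by linarith
    obtain ⟨s, L, hs, hL, hsa, hsb, hi⟩ :=
      exists_interpolation_scale hm (mul_pos hc0 ha) (mul_pos hc0 hb)
    have hu1 := hK u hu
      (fun j hj => ⟨_, norm_iteratedFDeriv_le_semiNorm hu hub hj⟩) s L hs hL
      (fun x => (norm_iteratedFDeriv_le_semiNorm hu hub (by omega) x).trans (by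
        rw [hsa]
        have : (n : ℝ) ^ 1 ≤ c := pow_le_pow_right₀ hn1 (by omega)
        gcongr
        linarith))
      (fun x => (norm_iteratedFDeriv_le_semiNorm hu hub le_rfl x).trans (by
        rw [hsb]
        gcongr
        linarith))
    have hterm (i) (h1 : i ∈ Finset.Icc 1 m) :
        s ^ i * ((N : ℝ) ^ m * semiNorm i Ψ) * L ^ m ≤ (N : ℝ) ^ m * c ^ m *
        (semiNorm i Ψ * (semiNorm 1 u + ε) ^ (((i : ℝ) - 1) * m / ((m : ℝ) - 1))
          * (semiNorm m u + ε) ^ (((m : ℝ) - i) / ((m : ℝ) - 1))) := by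
      rw [Finset.mem_Icc] at h1
      have hS := semiNorm_nonneg i Ψ
      have hcc : c ^ (((i : ℝ) - 1) * m / ((m : ℝ) - 1)) * c ^ (((m : ℝ) - i) / ((m : ℝ) - 1)) ≤
          c ^ m := by
        rw [← Real.rpow_add hc0]
        have : ((i : ℝ) - 1) * m / ((m : ℝ) - 1) + ((m : ℝ) - i) / ((m : ℝ) - 1) = i := by
          have : (m : ℝ) - 1 ≠ 0 := by linarith
          field_simp
          ring
        rw [this, Real.rpow_natCast]
        exact pow_le_pow_right₀ hc1 h1.2
      calc s ^ i * ((N : ℝ) ^ m * semiNorm i Ψ) * L ^ m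
          = (N : ℝ) ^ m * semiNorm i Ψ * (s ^ i * L ^ m) := by ring
        _ = (N : ℝ) ^ m * (c ^ (((i : ℝ) - 1) * m / ((m : ℝ) - 1)) *
              c ^ (((m : ℝ) - i) / ((m : ℝ) - 1))) *
            (semiNorm i Ψ * (semiNorm 1 u + ε) ^ (((i : ℝ) - 1) * m / ((m : ℝ) - 1))
              * (semiNorm m u + ε) ^ (((m : ℝ) - i) / ((m : ℝ) - 1))) := by
          rw [hi, Real.mul_rpow hc0.le ha.le, Real.mul_rpow hc0.le hb.le]
          ring
        _ ≤ _ := by gcongr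
    have hsum := Finset.sum_le_sum hterm
    rw [← Finset.sum_mul, ← Finset.mul_sum] at hsum
    refine semiNorm_le_of_norm_iteratedFDeriv_le (hΨ.comp hu) ?_ fun x => ?_
    · refine mul_nonneg (by positivity) (Finset.sum_nonneg fun i _ => ?_)
      have hS := semiNorm_nonneg i Ψ
      positivity
    · refine (norm_iteratedFDeriv_comp_le_sum hu hΨ (by omega) x hs
        (P := fun i => (N : ℝ) ^ m * semiNorm i Ψ) (L := K * L) (fun i _ him => ?_)
        (fun j h1 h2 => hu1 j h1 h2 x)).trans ?_
      · refine (norm_iteratedFDeriv_le_semiNorm hΨ hΨb him (u x)).trans ?_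
        exact mul_le_mul_of_nonneg_right (pow_le_pow_right₀ hN1 him) (semiNorm_nonneg i Ψ)
      · rw [mul_pow]
        have := mul_le_mul_of_nonneg_left hsum
          (show (0 : ℝ) ≤ m.factorial * K ^ m by positivity)
        linarith
  have hlim : ContinuousAt (fun ε : ℝ =>
      m.factorial * K ^ m * (N : ℝ) ^ m * c ^ m * ∑ i ∈ Finset.Icc 1 m,
        semiNorm i Ψ * (semiNorm 1 u + ε) ^ (((i : ℝ) - 1) * m / ((m : ℝ) - 1))
          * (semiNorm m u + ε) ^ (((m : ℝ) - i) / ((m : ℝ) - 1))) 0 := by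
    refine continuousAt_const.mul (tendsto_finsetSum _ fun i hi => ?_)
    rw [Finset.mem_Icc] at hi
    have h1 : (1 : ℝ) ≤ i := mod_cast hi.1
    have h2 : (i : ℝ) ≤ m := mod_cast hi.2
    have hp : 0 ≤ ((i : ℝ) - 1) * m / ((m : ℝ) - 1) :=
      div_nonneg (mul_nonneg (by linarith) (by linarith)) (by linarith)
    have hq : 0 ≤ ((m : ℝ) - i) / ((m : ℝ) - 1) := div_nonneg (by linarith) (by linarith)
    exact (continuousAt_const.mul ((continuousAt_const.add continuousAt_id).rpow_const
      (Or.inr hp))).mul ((continuousAt_const.add continuousAt_id).rpow_const (Or.inr hq))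
  have hge := ge_of_tendsto (hlim.mono_left (nhdsWithin_le_nhds (s := Set.Ioi 0)))
    (by filter_upwards [self_mem_nhdsWithin] with ε hε using main ε hε)
  simpa only [add_zero] using hge
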